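/- There is a universal constant C > 0 with the following property. Let n ≥ 1 be an integer, let L ≥ 2 be an integer, let φ : ℝ × ℝ → ℝⁿ be smooth and 2π-periodic in the second variable θ, and set f := −(∂_t²φ + ∂_θ²φ). Then for every point (t₀,θ₀) with |t₀| ≤ L − 1 one has |φ(t₀,θ₀)| ≤ max{ |(1/2π)∫_0^{2π} φ(−L,θ) dθ| , |(1/2π)∫_0^{2π} φ(L,θ) dθ| } + (1/2π) ∫_{−L}^{L} ∫_0^{2π} (L − |t|) |f| dθ dt + C · I^{1/2}, where I := e^{−(L−|t₀|)/9} ∫_{−L}^{L} ∫_0^{2π} |∇φ|² dθ dt + ∫_{−L}^{L} ∫_0^{2π} min{ e^{(1−|t−t₀|)/9}, 1 } |f|² dθ dt. -/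

import Mathlib

open MeasureTheory Real

/-- Partial derivative in the first (cylinder) variable `t`. -/
noncomputable def ptder {E : Type*} [NormedAddCommGroup E] [NormedSpace ℝ E]
    (φ : ℝ → ℝ → E) (t θ : ℝ) : E := deriv (fun s => φ s θ) t

/-- Partial derivative in the second (circle) variable `θ`. -/
noncomputable def pthder {E : Type*} [NormedAddCommGroup E] [NormedSpace ℝ E]
    (φ : ℝ → ℝ → E) (t θ : ℝ) : E := deriv (fun θ' => φ t θ') θ

section OneVariable

theorem cosh_sub_one_eq (x : ℝ) :
    cosh x - 1 = exp x * (1 - exp (-x)) ^ 2 / 2 := by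
  have h : exp x * exp (-x) = 1 := by rw [← exp_add]; simp
  rw [cosh_eq]
  linear_combination (1 - exp (-x) / 2) * h

theorem exp_le_mul_cosh_sub_one {x : ℝ} (hx : 1 / 9 ≤ x) :
    exp x ≤ 200 * (cosh x - 1) := by
  have h1 : (10 / 9 : ℝ) ≤ exp x := by linarith [add_one_le_exp x]
  have h2 : exp (-x) ≤ 9 / 10 := by
    rw [exp_neg]
    exact (inv_anti₀ (by norm_num) h1).trans (by norm_num)
  have h3 : (1 / 10 : ℝ) ^ 2 ≤ (1 - exp (-x)) ^ 2 := by gcongr; linarith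
  rw [cosh_sub_one_eq]
  nlinarith [mul_le_mul_of_nonneg_left h3 (exp_pos x).le]

theorem cosh_sub_one_le_mul_exp {x y : ℝ} (hx : 0 ≤ x) (hxy : x ≤ y) :
    cosh x - 1 ≤ (cosh y - 1) * exp (-(y - x)) := by
  have h1 : exp (-y) ≤ exp (-x) := by gcongr
  have h2 : exp (-x) ≤ 1 := exp_le_one_iff.2 (by linarith)
  have h3 : (1 - exp (-x)) ^ 2 ≤ (1 - exp (-y)) ^ 2 := by gcongr
  have h4 : exp y * exp (-(y - x)) = exp x := by rw [← exp_add]; ring_nf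
  rw [cosh_sub_one_eq, cosh_sub_one_eq]
  calc exp x * (1 - exp (-x)) ^ 2 / 2 ≤ exp x * (1 - exp (-y)) ^ 2 / 2 := by gcongr
    _ = _ := by rw [← h4]; ring

/-- One-sided decay estimate for subsolutions of `g'' = g / 81 - h`. -/
theorem subsolution_decay {g g' g'' h : ℝ → ℝ} {R : ℝ} (hR : 1 ≤ R)
    (hg : ∀ s, HasDerivAt g (g' s) s) (hg' : ∀ s, HasDerivAt g' (g'' s) s)
    (hcg : Continuous g'') (hch : Continuous h) (g0 : ∀ s, 0 ≤ g s) (h0 : ∀ s, 0 ≤ h s)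
    (hsub : ∀ s, g s / 81 - h s ≤ g'' s) :
    g' 0 + g 0 / 9 ≤ (∫ s in (0:ℝ)..R, exp (-s / 9) * h s)
      + 3 * exp (-R / 9) * ∫ s in (0:ℝ)..R, g s := by
  have cg : Continuous g := continuous_iff_continuousAt.2 fun s => (hg s).continuousAt
  have cg' : Continuous g' := continuous_iff_continuousAt.2 fun s => (hg' s).continuousAt
  set N := cosh (R / 9) - 1 with hN
  have hN0 : 0 < N := by
    have := exp_le_mul_cosh_sub_one (x := R / 9) (by linarith)
    have := exp_pos (R / 9)
    linarith
  set v : ℝ → ℝ := fun s => cosh ((R - s) / 9) - 1 with hv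
  have hlin : ∀ s, HasDerivAt (fun s : ℝ => (R - s) / 9) (-1 / 9) s := fun s =>
    ((hasDerivAt_id s).const_sub R).div_const 9
  have dv : ∀ s, HasDerivAt v (-(sinh ((R - s) / 9) / 9)) s := fun s => by
    exact (((hlin s).cosh).sub_const 1).congr_deriv (by ring)
  have dv' : ∀ s, HasDerivAt (fun s => -(sinh ((R - s) / 9) / 9))
      (cosh ((R - s) / 9) / 81) s := fun s => by
    exact (((hlin s).sinh).div_const 9).neg.congr_deriv (by ring)
  have dP : ∀ s, HasDerivAt (fun s => v s * g' s - -(sinh ((R - s) / 9) / 9) * g s)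
      (v s * g'' s - cosh ((R - s) / 9) / 81 * g s) s := fun s => by
    exact (((dv s).mul (hg' s)).sub ((dv' s).mul (hg s))).congr_deriv (by ring)
  have cP : Continuous fun s => v s * g'' s - cosh ((R - s) / 9) / 81 * g s := by
    simp only [hv]; fun_prop
  have key := intervalIntegral.integral_eq_sub_of_hasDerivAt (a := 0) (b := R)
    (fun s _ => dP s) (cP.intervalIntegrable _ _)
  have mono : ∫ s in (0:ℝ)..R, (-N * (exp (-s / 9) * h s) - 3 * N * exp (-R / 9) * g s) ≤
      ∫ s in (0:ℝ)..R, (v s * g'' s - cosh ((R - s) / 9) / 81 * g s) := by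
    refine intervalIntegral.integral_mono_on (by linarith)
      (Continuous.intervalIntegrable (by fun_prop) _ _) (cP.intervalIntegrable _ _) ?_
    intro s hs
    have hv0 : 0 ≤ v s := by have := one_le_cosh ((R - s) / 9); simp only [hv]; linarith
    have hvN : v s ≤ N * exp (-s / 9) := by
      have := cosh_sub_one_le_mul_exp (x := (R - s) / 9) (y := R / 9)
        (by linarith [hs.2]) (by linarith [hs.1])
      convert this using 3; ring
    have hNR : 1 ≤ 200 * (N * exp (-R / 9)) := by
      have h1 := exp_le_mul_cosh_sub_one (x := R / 9) (by linarith)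
      have h2 : exp (R / 9) * exp (-R / 9) = 1 := by rw [← exp_add, ← exp_zero]; ring_nf
      have := mul_le_mul_of_nonneg_right h1 (exp_pos (-R / 9)).le
      rw [h2] at this; rw [hN]; linarith
    have e1 := mul_le_mul_of_nonneg_left (hsub s) hv0
    have e2 := mul_le_mul_of_nonneg_right hvN (h0 s)
    have e3 := mul_le_mul_of_nonneg_right hNR (g0 s)
    have e4 : cosh ((R - s) / 9) = v s + 1 := by simp [hv]
    have e5 : 0 ≤ N * exp (-R / 9) * g s := by have := g0 s; positivity
    rw [e4]
    nlinarith
  rw [key, intervalIntegral.integral_sub (Continuous.intervalIntegrable (by fun_prop) _ _)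
    (Continuous.intervalIntegrable (by fun_prop) _ _), intervalIntegral.integral_const_mul,
    intervalIntegral.integral_const_mul] at mono
  have hsinh : N ≤ sinh (R / 9) := by
    have h1 := cosh_sub_sinh (R / 9)
    have h2 : exp (-(R / 9)) ≤ 1 := exp_le_one_iff.2 (by linarith)
    linarith
  have e6 := mul_le_mul_of_nonneg_right hsinh (g0 0)
  have e7 : v 0 = N := by simp [hv, hN]
  have e8 : v R = 0 := by simp [hv]
  simp only [e7, e8, sub_self, zero_div, sinh_zero, sub_zero, zero_mul, neg_zero] at mono
  refine le_of_mul_le_mul_left ?_ hN0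
  nlinarith

/-- Two-sided decay estimate for subsolutions of `g'' = g / 81 - h`. -/
theorem subsolution_pointwise {g g' g'' h : ℝ → ℝ} {L t₀ : ℝ} (ht : |t₀| ≤ L - 1)
    (hg : ∀ s, HasDerivAt g (g' s) s) (hg' : ∀ s, HasDerivAt g' (g'' s) s)
    (hcg : Continuous g'') (hch : Continuous h) (g0 : ∀ s, 0 ≤ g s) (h0 : ∀ s, 0 ≤ h s)
    (hsub : ∀ s, g s / 81 - h s ≤ g'' s) :
    2 / 9 * g t₀ ≤ (∫ t in (-L)..L, exp (-|t - t₀| / 9) * h t)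
      + 3 * exp (-(L - |t₀|) / 9) * ∫ t in (-L)..L, g t := by
  have cg : Continuous g := continuous_iff_continuousAt.2 fun s => (hg s).continuousAt
  obtain ⟨hl, hr⟩ := abs_le.1 ht
  have right := subsolution_decay (g := fun s => g (t₀ + s)) (g' := fun s => g' (t₀ + s))
    (g'' := fun s => g'' (t₀ + s)) (h := fun s => h (t₀ + s)) (R := L - t₀) (by linarith)
    (fun s => by simpa using (hg (t₀ + s)).comp_const_add t₀ s)
    (fun s => by simpa using (hg' (t₀ + s)).comp_const_add t₀ s)
    (by fun_prop) (by fun_prop) (fun s => g0 _) (fun s => h0 _) (fun s => hsub _)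
  have left := subsolution_decay (g := fun s => g (t₀ - s)) (g' := fun s => -g' (t₀ - s))
    (g'' := fun s => g'' (t₀ - s)) (h := fun s => h (t₀ - s)) (R := L + t₀) (by linarith)
    (fun s => by simpa using (hg (t₀ - s)).comp_const_sub t₀ s)
    (fun s => by simpa using ((hg' (t₀ - s)).comp_const_sub t₀ s).fun_neg)
    (by fun_prop) (by fun_prop) (fun s => g0 _) (fun s => h0 _) (fun s => hsub _)
  have r1 : ∫ s in (0:ℝ)..(L - t₀), exp (-s / 9) * h (t₀ + s) =
      ∫ t in t₀..L, exp (-|t - t₀| / 9) * h t := by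
    have := intervalIntegral.integral_comp_add_left (a := 0) (b := L - t₀)
      (fun t => exp (-|t - t₀| / 9) * h t) t₀
    rw [add_zero, add_sub_cancel] at this
    rw [← this]
    refine intervalIntegral.integral_congr fun s hs => ?_
    rw [Set.uIcc_of_le (by linarith)] at hs
    simp [abs_of_nonneg hs.1]
  have l1 : ∫ s in (0:ℝ)..(L + t₀), exp (-s / 9) * h (t₀ - s) =
      ∫ t in (-L)..t₀, exp (-|t - t₀| / 9) * h t := by
    have := intervalIntegral.integral_comp_sub_left (a := 0) (b := L + t₀)
      (fun t => exp (-|t - t₀| / 9) * h t) t₀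
    rw [sub_zero, sub_add_cancel_right] at this
    rw [← this]
    refine intervalIntegral.integral_congr fun s hs => ?_
    rw [Set.uIcc_of_le (by linarith)] at hs
    simp [abs_of_nonneg hs.1]
  have r2 : ∫ s in (0:ℝ)..(L - t₀), g (t₀ + s) = ∫ t in t₀..L, g t := by
    rw [intervalIntegral.integral_comp_add_left, add_zero, add_sub_cancel]
  have l2 : ∫ s in (0:ℝ)..(L + t₀), g (t₀ - s) = ∫ t in (-L)..t₀, g t := by
    rw [intervalIntegral.integral_comp_sub_left, sub_zero, sub_add_cancel_right]
  rw [r1, r2] at right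
  rw [l1, l2] at left
  have hr0 : 0 ≤ ∫ t in t₀..L, g t :=
    intervalIntegral.integral_nonneg (by linarith) fun s _ => g0 s
  have hl0 : 0 ≤ ∫ t in (-L)..t₀, g t :=
    intervalIntegral.integral_nonneg (by linarith) fun s _ => g0 s
  have er : exp (-(L - t₀) / 9) ≤ exp (-(L - |t₀|) / 9) := by
    gcongr; exact le_abs_self _
  have el : exp (-(L + t₀) / 9) ≤ exp (-(L - |t₀|) / 9) := by
    gcongr; linarith [neg_abs_le t₀]
  have s1 := intervalIntegral.integral_add_adjacent_intervals (a := -L) (b := t₀) (c := L)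
    (f := fun t => exp (-|t - t₀| / 9) * h t) (μ := volume)
    (Continuous.intervalIntegrable (by fun_prop) _ _)
    (Continuous.intervalIntegrable (by fun_prop) _ _)
  have s2 := intervalIntegral.integral_add_adjacent_intervals (a := -L) (b := t₀) (c := L)
    (cg.intervalIntegrable (μ := volume) _ _) (cg.intervalIntegrable _ _)
  rw [← s1, ← s2]
  have m1 := mul_le_mul_of_nonneg_right er hr0
  have m2 := mul_le_mul_of_nonneg_right el hl0
  simp only [add_zero, sub_zero] at right left
  linarith

end OneVariable

section Calculus

variable {E : Type*} [NormedAddCommGroup E]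

theorem hasDerivAt_intervalIntegral_of_continuous [NormedSpace ℝ E] {F F' : ℝ → ℝ → E} (a b : ℝ)
    (hF : Continuous (Function.uncurry F)) (hF' : Continuous (Function.uncurry F'))
    (h : ∀ x t, HasDerivAt (fun y => F y t) (F' x t) x) (x₀ : ℝ) :
    HasDerivAt (fun x => ∫ t in a..b, F x t) (∫ t in a..b, F' x₀ t) x₀ := by
  obtain ⟨M, hM⟩ := ((isCompact_closedBall x₀ 1).prod
    (isCompact_uIcc (a := a) (b := b))).exists_bound_of_continuousOn hF'.continuousOn
  refine (intervalIntegral.hasDerivAt_integral_of_dominated_loc_of_deriv_le (bound := fun _ => M)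
    (Metric.closedBall_mem_nhds x₀ one_pos) ?_ ?_ ?_ ?_ ?_ ?_).2
  · exact Filter.Eventually.of_forall fun x => (hF.uncurry_left x).aestronglyMeasurable
  · exact (hF.uncurry_left x₀).intervalIntegrable _ _
  · exact (hF'.uncurry_left x₀).aestronglyMeasurable
  · exact Filter.Eventually.of_forall fun t ht x hx =>
      hM (x, t) ⟨hx, Set.uIoc_subset_uIcc ht⟩
  · exact continuous_const.intervalIntegrable _ _
  · exact Filter.Eventually.of_forall fun t _ x _ => h x t

theorem sq_integral_le {u : ℝ → ℝ} (hu : Continuous u) {b : ℝ} (hb : 0 < b) :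
    (∫ x in (0:ℝ)..b, u x) ^ 2 ≤ b * ∫ x in (0:ℝ)..b, u x ^ 2 := by
  set c := ∫ x in (0:ℝ)..b, u x with hc
  have h : 0 ≤ ∫ x in (0:ℝ)..b, (b * u x - c) ^ 2 :=
    intervalIntegral.integral_nonneg hb.le fun x _ => sq_nonneg _
  have e : ∫ x in (0:ℝ)..b, (b * u x - c) ^ 2 =
      ∫ x in (0:ℝ)..b, ((b ^ 2 * u x ^ 2 - 2 * b * c * u x) + c ^ 2) := by
    congr 1; ext x; ring
  rw [e, intervalIntegral.integral_add (Continuous.intervalIntegrable (by fun_prop) _ _)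
    (Continuous.intervalIntegrable (by fun_prop) _ _), intervalIntegral.integral_sub
    (Continuous.intervalIntegrable (by fun_prop) _ _)
    (Continuous.intervalIntegrable (by fun_prop) _ _), intervalIntegral.integral_const_mul,
    intervalIntegral.integral_const_mul, ← hc, intervalIntegral.integral_const, smul_eq_mul] at h
  refine le_of_mul_le_mul_left ?_ hb
  nlinarith

/-- A periodic function deviates from its mean by at most the `L²` norm of its derivative. -/
theorem norm_sub_mean_sq_le [NormedSpace ℝ E] [CompleteSpace E] {g g' : ℝ → E}
    (hg : ∀ x, HasDerivAt g (g' x) x) (hg' : Continuous g') (hp : ∀ x, g (x + 2 * π) = g x)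
    (x : ℝ) :
    ‖g x - (2 * π)⁻¹ • ∫ y in (0:ℝ)..(2 * π), g y‖ ^ 2 ≤
      2 * π * ∫ y in (0:ℝ)..(2 * π), ‖g' y‖ ^ 2 := by
  have hpi : 0 < 2 * π := by positivity
  have cg : Continuous g := continuous_iff_continuousAt.2 fun s => (hg s).continuousAt
  have hp' : ∀ x, g' (x + 2 * π) = g' x := fun y => by
    have h1 := (hg (y + 2 * π)).comp_add_const y (2 * π)
    simp only [hp] at h1
    exact h1.unique (hg y)
  have hn : Function.Periodic (fun y => ‖g' y‖) (2 * π) := fun y => by simp only [hp']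
  have hA := hn.intervalIntegral_add_eq x 0
  have hm := Function.Periodic.intervalIntegral_add_eq (f := g) hp x 0
  rw [zero_add] at hA hm
  refine le_trans ?_ (sq_integral_le hg'.norm hpi)
  gcongr
  rw [← hA, ← hm]
  have osc : ∀ y ∈ Set.uIoc x (x + 2 * π), ‖g x - g y‖ ≤ ∫ z in x..x + 2 * π, ‖g' z‖ := by
    intro y hy
    rw [Set.uIoc_of_le (by linarith)] at hy
    rw [norm_sub_rev, ← intervalIntegral.integral_eq_sub_of_hasDerivAt (fun s _ => hg s)
      (hg'.intervalIntegrable _ _)]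
    refine (intervalIntegral.norm_integral_le_integral_norm hy.1.le).trans ?_
    exact intervalIntegral.integral_mono_interval le_rfl hy.1.le hy.2
      (Filter.Eventually.of_forall fun z => norm_nonneg _) (hg'.norm.intervalIntegrable _ _)
  have e : g x - (2 * π)⁻¹ • ∫ y in x..x + 2 * π, g y =
      (2 * π)⁻¹ • ∫ y in x..x + 2 * π, (g x - g y) := by
    rw [intervalIntegral.integral_sub (Continuous.intervalIntegrable (by fun_prop) _ _)
      (cg.intervalIntegrable _ _), intervalIntegral.integral_const, smul_sub, smul_smul,
      add_sub_cancel_left, inv_mul_cancel₀ hpi.ne', one_smul]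
  rw [e, norm_smul, norm_of_nonneg (inv_pos.2 hpi).le]
  have := intervalIntegral.norm_integral_le_of_norm_le_const osc
  rw [add_sub_cancel_left, abs_of_pos hpi] at this
  rw [inv_mul_le_iff₀ hpi]
  linarith

theorem integral_deriv_eq_zero_of_periodic [NormedSpace ℝ E] [CompleteSpace E] {g g' : ℝ → E}
    (hg : ∀ x, HasDerivAt g (g' x) x) (hg' : Continuous g') (hp : ∀ x, g (x + 2 * π) = g x) :
    ∫ y in (0:ℝ)..(2 * π), g' y = 0 := by
  rw [intervalIntegral.integral_eq_sub_of_hasDerivAt (fun s _ => hg s)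
    (hg'.intervalIntegrable _ _), ← hp 0, zero_add, sub_self]

/-- Wirtinger's inequality with a non-sharp constant. -/
theorem integral_norm_sq_le_of_periodic [NormedSpace ℝ E] [CompleteSpace E] {g g' : ℝ → E}
    (hg : ∀ x, HasDerivAt g (g' x) x) (hg' : Continuous g') (hp : ∀ x, g (x + 2 * π) = g x)
    (h0 : ∫ y in (0:ℝ)..(2 * π), g y = 0) :
    ∫ y in (0:ℝ)..(2 * π), ‖g y‖ ^ 2 ≤ 81 * ∫ y in (0:ℝ)..(2 * π), ‖g' y‖ ^ 2 := by
  have hpi : 0 < 2 * π := by positivity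
  have cg : Continuous g := continuous_iff_continuousAt.2 fun s => (hg s).continuousAt
  have hnn : 0 ≤ ∫ y in (0:ℝ)..(2 * π), ‖g' y‖ ^ 2 :=
    intervalIntegral.integral_nonneg hpi.le fun s _ => sq_nonneg _
  have h1 : ∫ y in (0:ℝ)..(2 * π), ‖g y‖ ^ 2 ≤
      ∫ y in (0:ℝ)..(2 * π), 2 * π * ∫ y in (0:ℝ)..(2 * π), ‖g' y‖ ^ 2 := by
    refine intervalIntegral.integral_mono_on hpi.le
      (Continuous.intervalIntegrable (by fun_prop) _ _) (by simp) fun y _ => ?_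
    simpa [h0] using norm_sub_mean_sq_le hg hg' hp y
  rw [intervalIntegral.integral_const, smul_eq_mul, sub_zero] at h1
  have h2 : 2 * π ≤ 8 := by linarith [pi_lt_four]
  nlinarith [mul_le_mul h2 h2 hpi.le (by norm_num)]

/-- Green's representation bound for `m'' = -f` on an interval. -/
theorem norm_le_max_add_integral [NormedSpace ℝ E] [CompleteSpace E] {m m' m'' : ℝ → E}
    {L t₀ : ℝ} (ht : |t₀| ≤ L) (hL : 0 < L)
    (hm : ∀ t, HasDerivAt m (m' t) t) (hm' : ∀ t, HasDerivAt m' (m'' t) t)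
    (hc : Continuous m'') :
    ‖m t₀‖ ≤ max ‖m (-L)‖ ‖m L‖ + ∫ t in (-L)..L, (L - |t|) * ‖m'' t‖ := by
  obtain ⟨hl, hr⟩ := abs_le.1 ht
  have right : ∫ s in t₀..L, (L - s) • m'' s = m L - (m t₀ + (L - t₀) • m' t₀) := by
    have d : ∀ s, HasDerivAt (fun s => (L - s) • m' s + m s) ((L - s) • m'' s) s := fun s => by
      have := ((((hasDerivAt_id s).const_sub L).smul (hm' s)).add (hm s))
      exact this.congr_deriv (by simp)
    rw [intervalIntegral.integral_eq_sub_of_hasDerivAt (fun s _ => d s)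
      (Continuous.intervalIntegrable (by fun_prop) _ _)]
    simp only [sub_self, zero_smul]; abel
  have left : ∫ s in (-L)..t₀, (L + s) • m'' s = m (-L) - (m t₀ - (L + t₀) • m' t₀) := by
    have d : ∀ s, HasDerivAt (fun s => (L + s) • m' s - m s) ((L + s) • m'' s) s := fun s => by
      have := ((((hasDerivAt_id s).const_add L).smul (hm' s)).sub (hm s))
      exact this.congr_deriv (by simp)
    rw [intervalIntegral.integral_eq_sub_of_hasDerivAt (fun s _ => d s)
      (Continuous.intervalIntegrable (by fun_prop) _ _)]
    simp only [add_neg_cancel, zero_smul]; abel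
  have rep : (2 * L) • m t₀ = (L + t₀) • m L + (L - t₀) • m (-L)
      - ((L + t₀) • ∫ s in t₀..L, (L - s) • m'' s)
      - (L - t₀) • ∫ s in (-L)..t₀, (L + s) • m'' s := by
    rw [right, left]; module
  have br : ‖(L + t₀) • ∫ s in t₀..L, (L - s) • m'' s‖ ≤
      2 * L * ∫ t in t₀..L, (L - |t|) * ‖m'' t‖ := by
    rw [← intervalIntegral.integral_smul, ← intervalIntegral.integral_const_mul]
    refine (intervalIntegral.norm_integral_le_integral_norm hr).trans ?_
    refine intervalIntegral.integral_mono_on hr (Continuous.intervalIntegrable (by fun_prop) _ _)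
      (Continuous.intervalIntegrable (by fun_prop) _ _) fun s hs => ?_
    rw [smul_smul, norm_smul, ← mul_assoc, norm_of_nonneg
      (mul_nonneg (by linarith) (by linarith [hs.2]))]
    refine mul_le_mul_of_nonneg_right ?_ (norm_nonneg _)
    obtain ⟨h1, h2⟩ := hs
    rcases abs_cases s with ⟨h, h'⟩ | ⟨h, h'⟩ <;> rw [h] <;> nlinarith
  have bl : ‖(L - t₀) • ∫ s in (-L)..t₀, (L + s) • m'' s‖ ≤
      2 * L * ∫ t in (-L)..t₀, (L - |t|) * ‖m'' t‖ := by
    rw [← intervalIntegral.integral_smul, ← intervalIntegral.integral_const_mul]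
    refine (intervalIntegral.norm_integral_le_integral_norm hl).trans ?_
    refine intervalIntegral.integral_mono_on hl (Continuous.intervalIntegrable (by fun_prop) _ _)
      (Continuous.intervalIntegrable (by fun_prop) _ _) fun s hs => ?_
    rw [smul_smul, norm_smul, ← mul_assoc, norm_of_nonneg
      (mul_nonneg (by linarith) (by linarith [hs.1]))]
    refine mul_le_mul_of_nonneg_right ?_ (norm_nonneg _)
    obtain ⟨h1, h2⟩ := hs
    rcases abs_cases s with ⟨h, h'⟩ | ⟨h, h'⟩ <;> rw [h] <;> nlinarith
  have s1 := intervalIntegral.integral_add_adjacent_intervals (a := -L) (b := t₀) (c := L)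
    (f := fun t => (L - |t|) * ‖m'' t‖) (μ := volume)
    (Continuous.intervalIntegrable (by fun_prop) _ _)
    (Continuous.intervalIntegrable (by fun_prop) _ _)
  have b1 : ‖(L + t₀) • m L‖ ≤ (L + t₀) * max ‖m (-L)‖ ‖m L‖ := by
    rw [norm_smul, norm_of_nonneg (by linarith)]
    exact mul_le_mul_of_nonneg_left (le_max_right _ _) (by linarith)
  have b2 : ‖(L - t₀) • m (-L)‖ ≤ (L - t₀) * max ‖m (-L)‖ ‖m L‖ := by
    rw [norm_smul, norm_of_nonneg (by linarith)]
    exact mul_le_mul_of_nonneg_left (le_max_left _ _) (by linarith)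
  have n0 : 2 * L * ‖m t₀‖ = ‖(2 * L) • m t₀‖ := by
    rw [norm_smul, norm_of_nonneg (by linarith)]
  rw [← s1]
  refine le_of_mul_le_mul_left ?_ (show 0 < 2 * L by linarith)
  rw [n0, rep]
  refine (norm_sub_le _ _).trans ?_
  have t1 := norm_sub_le ((L + t₀) • m L + (L - t₀) • m (-L))
    ((L + t₀) • ∫ s in t₀..L, (L - s) • m'' s)
  have t2 := norm_add_le ((L + t₀) • m L) ((L - t₀) • m (-L))
  linarith

end Calculus

section Cylinder

variable {E : Type*} [NormedAddCommGroup E]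

section Smooth

variable [NormedSpace ℝ E] {φ : ℝ → ℝ → E}

theorem hasDerivAt_fst_fderiv (hφ : ContDiff ℝ (⊤ : ℕ∞) (fun p : ℝ × ℝ => φ p.1 p.2)) (t θ : ℝ) :
    HasDerivAt (fun s => φ s θ) (fderiv ℝ (fun p : ℝ × ℝ => φ p.1 p.2) (t, θ) (1, 0)) t :=
  ((hφ.differentiable (by simp)) (t, θ)).hasFDerivAt.comp_hasDerivAt
    (f := fun s : ℝ => (s, θ)) t ((hasDerivAt_id t).prodMk (hasDerivAt_const t θ))

theorem hasDerivAt_snd_fderiv (hφ : ContDiff ℝ (⊤ : ℕ∞) (fun p : ℝ × ℝ => φ p.1 p.2)) (t θ : ℝ) :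
    HasDerivAt (fun s => φ t s) (fderiv ℝ (fun p : ℝ × ℝ => φ p.1 p.2) (t, θ) (0, 1)) θ :=
  ((hφ.differentiable (by simp)) (t, θ)).hasFDerivAt.comp_hasDerivAt
    (f := fun s : ℝ => (t, s)) θ ((hasDerivAt_const θ t).prodMk (hasDerivAt_id θ))

theorem hasDerivAt_ptder (hφ : ContDiff ℝ (⊤ : ℕ∞) (fun p : ℝ × ℝ => φ p.1 p.2)) (t θ : ℝ) :
    HasDerivAt (fun s => φ s θ) (ptder φ t θ) t :=
  (hasDerivAt_fst_fderiv hφ t θ).differentiableAt.hasDerivAt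

theorem hasDerivAt_pthder (hφ : ContDiff ℝ (⊤ : ℕ∞) (fun p : ℝ × ℝ => φ p.1 p.2)) (t θ : ℝ) :
    HasDerivAt (fun s => φ t s) (pthder φ t θ) θ :=
  (hasDerivAt_snd_fderiv hφ t θ).differentiableAt.hasDerivAt

theorem ptder_eq_fderiv (hφ : ContDiff ℝ (⊤ : ℕ∞) (fun p : ℝ × ℝ => φ p.1 p.2)) (t θ : ℝ) :
    ptder φ t θ = fderiv ℝ (fun p : ℝ × ℝ => φ p.1 p.2) (t, θ) (1, 0) :=
  (hasDerivAt_fst_fderiv hφ t θ).deriv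

theorem pthder_eq_fderiv (hφ : ContDiff ℝ (⊤ : ℕ∞) (fun p : ℝ × ℝ => φ p.1 p.2)) (t θ : ℝ) :
    pthder φ t θ = fderiv ℝ (fun p : ℝ × ℝ => φ p.1 p.2) (t, θ) (0, 1) :=
  (hasDerivAt_snd_fderiv hφ t θ).deriv

theorem contDiff_ptder (hφ : ContDiff ℝ (⊤ : ℕ∞) (fun p : ℝ × ℝ => φ p.1 p.2)) :
    ContDiff ℝ (⊤ : ℕ∞) (fun p : ℝ × ℝ => ptder φ p.1 p.2) := by
  simp only [ptder_eq_fderiv hφ]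
  exact (hφ.fderiv_right (m := (⊤ : ℕ∞)) (by simp)).clm_apply contDiff_const

theorem contDiff_pthder (hφ : ContDiff ℝ (⊤ : ℕ∞) (fun p : ℝ × ℝ => φ p.1 p.2)) :
    ContDiff ℝ (⊤ : ℕ∞) (fun p : ℝ × ℝ => pthder φ p.1 p.2) := by
  simp only [pthder_eq_fderiv hφ]
  exact (hφ.fderiv_right (m := (⊤ : ℕ∞)) (by simp)).clm_apply contDiff_const

theorem ptder_pthder_comm (hφ : ContDiff ℝ (⊤ : ℕ∞) (fun p : ℝ × ℝ => φ p.1 p.2)) :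
    ptder (pthder φ) = pthder (ptder φ) := by
  ext t θ
  have hd : DifferentiableAt ℝ (fderiv ℝ (fun p : ℝ × ℝ => φ p.1 p.2)) (t, θ) :=
    (hφ.fderiv_right (m := (⊤ : ℕ∞)) (by simp)).differentiable (by simp) _
  rw [ptder_eq_fderiv (contDiff_pthder hφ), pthder_eq_fderiv (contDiff_ptder hφ)]
  simp only [ptder_eq_fderiv hφ, pthder_eq_fderiv hφ]
  rw [fderiv_clm_apply hd (by fun_prop), fderiv_clm_apply hd (by fun_prop)]
  simpa using hφ.contDiffAt.isSymmSndFDerivAt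
    (by simpa using WithTop.coe_le_coe.2 (le_top : (2 : ℕ∞) ≤ ⊤)) (1, 0) (0, 1)

theorem ptder_periodic (hp : ∀ t θ, φ t (θ + 2 * π) = φ t θ) (t θ : ℝ) :
    ptder φ t (θ + 2 * π) = ptder φ t θ := by
  simp only [ptder, hp]

theorem pthder_periodic (hp : ∀ t θ, φ t (θ + 2 * π) = φ t θ) (t θ : ℝ) :
    pthder φ t (θ + 2 * π) = pthder φ t θ := by
  have := deriv_comp_add_const (φ t) (2 * π) θ
  simp only [hp] at this
  exact this.symm

end Smooth

variable [InnerProductSpace ℝ E] [CompleteSpace E] {φ f : ℝ → ℝ → E}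

/-- The energy `∫ ‖∂_θ φ‖²` over circles is a subsolution of `y'' = y / 81 - ∫ ‖f‖²`. -/
theorem circle_energy_subsolution
    (hφ : ContDiff ℝ (⊤ : ℕ∞) (fun p : ℝ × ℝ => φ p.1 p.2))
    (hp : ∀ t θ : ℝ, φ t (θ + 2 * π) = φ t θ)
    (hf : ∀ t θ : ℝ, f t θ = -(ptder (ptder φ) t θ + pthder (pthder φ) t θ)) (t : ℝ) :
    (∫ θ in (0:ℝ)..(2 * π), ‖pthder φ t θ‖ ^ 2) / 81 - ∫ θ in (0:ℝ)..(2 * π), ‖f t θ‖ ^ 2 ≤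
      ∫ θ in (0:ℝ)..(2 * π), 2 * (inner ℝ (pthder φ t θ) (ptder (ptder (pthder φ)) t θ)
        + inner ℝ (ptder (pthder φ) t θ) (ptder (pthder φ) t θ)) := by
  have sg := contDiff_pthder hφ
  have sgθ := contDiff_pthder sg
  have sA := contDiff_ptder sg
  have sB := contDiff_ptder sA
  have sφt := contDiff_ptder hφ
  have sW := contDiff_ptder sφt
  have sec : ∀ {ψ : ℝ → ℝ → E}, ContDiff ℝ (⊤ : ℕ∞) (fun p : ℝ × ℝ => ψ p.1 p.2) →
      Continuous (ψ t) := fun h => h.continuous.comp (Continuous.prodMk_right t)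
  have cg := sec sg
  have cgθ := sec sgθ
  have cA := sec sA
  have cB := sec sB
  have cW := sec sW
  have cf : Continuous (f t) := by
    have : f t = fun θ => -(ptder (ptder φ) t θ + pthder (pthder φ) t θ) := funext (hf t)
    rw [this]; fun_prop
  have hB : ptder (ptder (pthder φ)) = pthder (ptder (ptder φ)) := by
    rw [ptder_pthder_comm hφ, ptder_pthder_comm sφt]
  have wirt := integral_norm_sq_le_of_periodic (hasDerivAt_pthder sg t) cgθ
    (pthder_periodic hp t)
    (integral_deriv_eq_zero_of_periodic (hasDerivAt_pthder hφ t) cg (hp t))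
  have parts : ∫ θ in (0:ℝ)..(2 * π), (inner ℝ (pthder φ t θ) (ptder (ptder (pthder φ)) t θ)
      + inner ℝ (pthder (pthder φ) t θ) (ptder (ptder φ) t θ)) = 0 := by
    refine integral_deriv_eq_zero_of_periodic
      (g := fun θ => inner ℝ (pthder φ t θ) (ptder (ptder φ) t θ)) (fun θ => ?_)
      (by fun_prop) (fun θ => ?_)
    · rw [hB]
      exact (hasDerivAt_pthder sg t θ).inner ℝ (hasDerivAt_pthder sW t θ)
    · rw [pthder_periodic hp, ptder_periodic (ptder_periodic hp)]
  have mono : ∫ θ in (0:ℝ)..(2 * π), (‖pthder (pthder φ) t θ‖ ^ 2 - ‖f t θ‖ ^ 2) ≤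
      ∫ θ in (0:ℝ)..(2 * π), (2 * (inner ℝ (pthder φ t θ) (ptder (ptder (pthder φ)) t θ)
        + inner ℝ (ptder (pthder φ) t θ) (ptder (pthder φ) t θ))
        - 2 * (inner ℝ (pthder φ t θ) (ptder (ptder (pthder φ)) t θ)
      + inner ℝ (pthder (pthder φ) t θ) (ptder (ptder φ) t θ))) := by
    refine intervalIntegral.integral_mono_on (by positivity)
      (Continuous.intervalIntegrable (by fun_prop) _ _)
      (Continuous.intervalIntegrable (by fun_prop) _ _) fun θ _ => ?_
    have hW : ptder (ptder φ) t θ = -f t θ - pthder (pthder φ) t θ := by rw [hf]; abel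
    have h1 := norm_add_sq_real (f t θ) (pthder (pthder φ) t θ)
    have h2 := sq_nonneg ‖f t θ + pthder (pthder φ) t θ‖
    rw [hW, inner_sub_right, inner_neg_right, real_inner_self_eq_norm_sq,
      real_inner_self_eq_norm_sq, real_inner_comm (f t θ)]
    nlinarith [sq_nonneg ‖ptder (pthder φ) t θ‖]
  rw [intervalIntegral.integral_sub (Continuous.intervalIntegrable (by fun_prop) _ _)
    (Continuous.intervalIntegrable (by fun_prop) _ _), intervalIntegral.integral_sub
    (Continuous.intervalIntegrable (by fun_prop) _ _)
    (Continuous.intervalIntegrable (by fun_prop) _ _),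
    intervalIntegral.integral_const_mul (2:ℝ) (fun θ =>
      inner ℝ (pthder φ t θ) (ptder (ptder (pthder φ)) t θ)
      + inner ℝ (pthder (pthder φ) t θ) (ptder (ptder φ) t θ)), parts, mul_zero, sub_zero] at mono
  linarith

theorem circle_energy_le
    (hφ : ContDiff ℝ (⊤ : ℕ∞) (fun p : ℝ × ℝ => φ p.1 p.2))
    (hp : ∀ t θ : ℝ, φ t (θ + 2 * π) = φ t θ)
    (hf : ∀ t θ : ℝ, f t θ = -(ptder (ptder φ) t θ + pthder (pthder φ) t θ))
    {L t₀ : ℝ} (ht : |t₀| ≤ L - 1) :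
    2 / 9 * ∫ θ in (0:ℝ)..(2 * π), ‖pthder φ t₀ θ‖ ^ 2 ≤
      (∫ t in (-L)..L, exp (-|t - t₀| / 9) * ∫ θ in (0:ℝ)..(2 * π), ‖f t θ‖ ^ 2)
      + 3 * exp (-(L - |t₀|) / 9) *
        ∫ t in (-L)..L, ∫ θ in (0:ℝ)..(2 * π), ‖pthder φ t θ‖ ^ 2 := by
  have sg := contDiff_pthder hφ
  have sA := contDiff_ptder sg
  have sB := contDiff_ptder sA
  have cg := sg.continuous
  have cA := sA.continuous
  have cB := sB.continuous
  have cf : Continuous (fun p : ℝ × ℝ => f p.1 p.2) := by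
    simp only [hf]
    exact ((contDiff_ptder (contDiff_ptder hφ)).continuous.add
      (contDiff_pthder sg).continuous).neg
  refine subsolution_pointwise ht
    (g := fun t => ∫ θ in (0:ℝ)..(2 * π), ‖pthder φ t θ‖ ^ 2)
    (h := fun t => ∫ θ in (0:ℝ)..(2 * π), ‖f t θ‖ ^ 2)
    (g' := fun t => ∫ θ in (0:ℝ)..(2 * π), 2 * inner ℝ (pthder φ t θ) (ptder (pthder φ) t θ))
    (hasDerivAt_intervalIntegral_of_continuous _ _ ?_ ?_ fun t θ => ?_)
    (hasDerivAt_intervalIntegral_of_continuous _ _ ?_ ?_ fun t θ => ?_) ?_ ?_ ?_ ?_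
    (circle_energy_subsolution hφ hp hf)
  · simp only [Function.uncurry_def]; fun_prop
  · simp only [Function.uncurry_def]; fun_prop
  · exact (hasDerivAt_ptder sg t θ).norm_sq
  · simp only [Function.uncurry_def]; fun_prop
  · simp only [Function.uncurry_def]; fun_prop
  · exact ((hasDerivAt_ptder sg t θ).inner ℝ (hasDerivAt_ptder sA t θ)).const_mul 2
  · refine intervalIntegral.continuous_parametric_intervalIntegral_of_continuous' ?_ _ _
    simp only [Function.uncurry_def]; fun_prop
  · refine intervalIntegral.continuous_parametric_intervalIntegral_of_continuous' ?_ _ _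
    simp only [Function.uncurry_def]; fun_prop
  · exact fun t => intervalIntegral.integral_nonneg (by positivity) fun _ _ => sq_nonneg _
  · exact fun t => intervalIntegral.integral_nonneg (by positivity) fun _ _ => sq_nonneg _

theorem norm_circle_mean_le
    (hφ : ContDiff ℝ (⊤ : ℕ∞) (fun p : ℝ × ℝ => φ p.1 p.2))
    (hp : ∀ t θ : ℝ, φ t (θ + 2 * π) = φ t θ)
    (hf : ∀ t θ : ℝ, f t θ = -(ptder (ptder φ) t θ + pthder (pthder φ) t θ))
    {L t₀ : ℝ} (ht : |t₀| ≤ L) (hL : 0 < L) :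
    ‖(2 * π)⁻¹ • ∫ θ in (0:ℝ)..(2 * π), φ t₀ θ‖ ≤
      max ‖(2 * π)⁻¹ • ∫ θ in (0:ℝ)..(2 * π), φ (-L) θ‖
          ‖(2 * π)⁻¹ • ∫ θ in (0:ℝ)..(2 * π), φ L θ‖
      + (2 * π)⁻¹ * ∫ t in (-L)..L, ∫ θ in (0:ℝ)..(2 * π), (L - |t|) * ‖f t θ‖ := by
  have sφt := contDiff_ptder hφ
  have sW := contDiff_ptder sφt
  have sgθ := contDiff_pthder (contDiff_pthder hφ)
  have cf : Continuous (fun p : ℝ × ℝ => f p.1 p.2) := by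
    simp only [hf]
    exact (sW.continuous.add sgθ.continuous).neg
  have sec : ∀ {ψ : ℝ → ℝ → E}, Continuous (fun p : ℝ × ℝ => ψ p.1 p.2) →
      ∀ t, Continuous (ψ t) := fun h t => h.comp (Continuous.prodMk_right t)
  have cW : Continuous fun t => ∫ θ in (0:ℝ)..(2 * π), ptder (ptder φ) t θ :=
    intervalIntegral.continuous_parametric_intervalIntegral_of_continuous' sW.continuous _ _
  have cn : Continuous fun t => ∫ θ in (0:ℝ)..(2 * π), ‖f t θ‖ :=
    intervalIntegral.continuous_parametric_intervalIntegral_of_continuous' cf.norm _ _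
  have main := norm_le_max_add_integral ht hL
    (m := fun t => (2 * π)⁻¹ • ∫ θ in (0:ℝ)..(2 * π), φ t θ)
    (fun t => (hasDerivAt_intervalIntegral_of_continuous (F := φ) (F' := ptder φ)
      0 (2 * π) hφ.continuous sφt.continuous
      (hasDerivAt_ptder hφ) t).const_smul (2 * π)⁻¹)
    (fun t => (hasDerivAt_intervalIntegral_of_continuous (F := ptder φ) (F' := ptder (ptder φ))
      0 (2 * π) sφt.continuous sW.continuous
      (hasDerivAt_ptder sφt) t).const_smul (2 * π)⁻¹) (by fun_prop)
  refine main.trans (add_le_add_right ?_ _)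
  simp only [intervalIntegral.integral_const_mul]
  rw [← intervalIntegral.integral_const_mul]
  refine intervalIntegral.integral_mono_on (by linarith)
    (Continuous.intervalIntegrable (by fun_prop) _ _)
    (Continuous.intervalIntegrable (by fun_prop) _ _) fun t hts => ?_
  have hW : ∫ θ in (0:ℝ)..(2 * π), ptder (ptder φ) t θ = -∫ θ in (0:ℝ)..(2 * π), f t θ := by
    have h0 := integral_deriv_eq_zero_of_periodic (hasDerivAt_pthder (contDiff_pthder hφ) t)
      (sec sgθ.continuous t) (pthder_periodic hp t)
    simp only [hf, intervalIntegral.integral_neg]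
    rw [intervalIntegral.integral_add ((sec sW.continuous t).intervalIntegrable _ _)
      ((sec sgθ.continuous t).intervalIntegrable _ _), h0, add_zero, neg_neg]
  have hLt : 0 ≤ L - |t| := sub_nonneg.2 (abs_le.2 hts)
  have hn := intervalIntegral.norm_integral_le_integral_norm (f := f t) (μ := volume)
    (show (0:ℝ) ≤ 2 * π by positivity)
  rw [hW, norm_smul, norm_neg, norm_of_nonneg (by positivity), mul_left_comm]
  gcongr

end Cylinder

/-- Lemma 5.2 (pointwise `L^∞` estimate): for smooth `2π`-periodic solutions of `-Δφ = f`
on the cylinder `[-L,L] × T¹`, a pointwise bound in the interior holds. -/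
theorem pointwise_estimate :
    ∃ C : ℝ, 0 < C ∧
      ∀ (n : ℕ), 1 ≤ n → ∀ (L : ℕ), 2 ≤ L →
      ∀ (φ f : ℝ → ℝ → EuclideanSpace ℝ (Fin n)),
        ContDiff ℝ (⊤ : ℕ∞) (fun p : ℝ × ℝ => φ p.1 p.2) →
        (∀ t θ : ℝ, φ t (θ + 2 * π) = φ t θ) →
        (∀ t θ : ℝ, f t θ = -(ptder (ptder φ) t θ + pthder (pthder φ) t θ)) →
        ∀ t₀ θ₀ : ℝ, |t₀| ≤ (L : ℝ) - 1 →
          ‖φ t₀ θ₀‖ ≤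
            max ‖(2 * π)⁻¹ • ∫ θ in (0:ℝ)..(2 * π), φ (-(L : ℝ)) θ‖
                ‖(2 * π)⁻¹ • ∫ θ in (0:ℝ)..(2 * π), φ (L : ℝ) θ‖
            + (2 * π)⁻¹ * (∫ t in (-(L : ℝ))..(L : ℝ), ∫ θ in (0:ℝ)..(2 * π),
                ((L : ℝ) - |t|) * ‖f t θ‖)
            + C * Real.sqrt
                (Real.exp (-((L : ℝ) - |t₀|) / 9) *
                    (∫ t in (-(L : ℝ))..(L : ℝ), ∫ θ in (0:ℝ)..(2 * π),
                      (‖ptder φ t θ‖ ^ 2 + ‖pthder φ t θ‖ ^ 2))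
                  + ∫ t in (-(L : ℝ))..(L : ℝ), ∫ θ in (0:ℝ)..(2 * π),
                      min (Real.exp ((1 - |t - t₀|) / 9)) 1 * ‖f t θ‖ ^ 2) := by
  refine ⟨10, by norm_num, fun n _ L hL φ f hφ hp hf t₀ θ₀ ht => ?_⟩
  have hL' : (2 : ℝ) ≤ L := by exact_mod_cast hL
  have cf : Continuous (fun p : ℝ × ℝ => f p.1 p.2) := by
    simp only [hf]
    exact ((contDiff_ptder (contDiff_ptder hφ)).continuous.add
      (contDiff_pthder (contDiff_pthder hφ)).continuous).neg
  have cg := (contDiff_pthder hφ).continuous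
  have ct := (contDiff_ptder hφ).continuous
  have sec : ∀ {ψ : ℝ → ℝ → EuclideanSpace ℝ (Fin n)}, Continuous (fun p : ℝ × ℝ => ψ p.1 p.2) →
      ∀ t, Continuous (ψ t) := fun h t => h.comp (Continuous.prodMk_right t)
  have cint : ∀ {u : ℝ → ℝ → ℝ}, Continuous (Function.uncurry u) →
      Continuous fun t => ∫ θ in (0:ℝ)..(2 * π), u t θ := fun h =>
    intervalIntegral.continuous_parametric_intervalIntegral_of_continuous' h _ _
  have hmean := norm_circle_mean_le hφ hp hf (L := L) (t₀ := t₀) (by linarith) (by linarith)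
  have hosc := norm_sub_mean_sq_le (hasDerivAt_pthder hφ t₀) (sec cg t₀) (hp t₀) θ₀
  have hen := circle_energy_le hφ hp hf ht
  have hgrad : ∫ t in (-(L : ℝ))..(L : ℝ), ∫ θ in (0:ℝ)..(2 * π), ‖pthder φ t θ‖ ^ 2 ≤
      ∫ t in (-(L : ℝ))..(L : ℝ), ∫ θ in (0:ℝ)..(2 * π),
        (‖ptder φ t θ‖ ^ 2 + ‖pthder φ t θ‖ ^ 2) := by
    refine intervalIntegral.integral_mono_on (by linarith)
      ((cint (u := fun t θ => ‖pthder φ t θ‖ ^ 2)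
        (by simp only [Function.uncurry_def]; fun_prop)).intervalIntegrable _ _)
      ((cint (u := fun t θ => ‖ptder φ t θ‖ ^ 2 + ‖pthder φ t θ‖ ^ 2)
        (by simp only [Function.uncurry_def]; fun_prop)).intervalIntegrable _ _) fun t _ => ?_
    exact intervalIntegral.integral_mono_on (by positivity)
      (((sec cg t).norm.pow 2).intervalIntegrable _ _)
      ((((sec ct t).norm.pow 2).add ((sec cg t).norm.pow 2)).intervalIntegrable _ _)
      fun θ _ => le_add_of_nonneg_left (sq_nonneg _)
  have hweight : (∫ t in (-(L : ℝ))..(L : ℝ), exp (-|t - t₀| / 9) *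
        ∫ θ in (0:ℝ)..(2 * π), ‖f t θ‖ ^ 2) ≤
      ∫ t in (-(L : ℝ))..(L : ℝ), ∫ θ in (0:ℝ)..(2 * π),
        min (exp ((1 - |t - t₀|) / 9)) 1 * ‖f t θ‖ ^ 2 := by
    have cF : Continuous fun t => ∫ θ in (0:ℝ)..(2 * π), ‖f t θ‖ ^ 2 :=
      cint (by simp only [Function.uncurry_def]; fun_prop)
    simp only [intervalIntegral.integral_const_mul]
    refine intervalIntegral.integral_mono_on (by linarith)
      (Continuous.intervalIntegrable (by fun_prop) _ _)
      (Continuous.intervalIntegrable (by fun_prop) _ _) fun t _ => ?_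
    refine mul_le_mul_of_nonneg_right (le_min ?_ ?_)
      (intervalIntegral.integral_nonneg (by positivity) fun _ _ => sq_nonneg _)
    · gcongr; linarith
    · exact exp_le_one_iff.2 (by linarith [abs_nonneg (t - t₀)])
  have hD0 : 0 ≤ ∫ t in (-(L : ℝ))..(L : ℝ), ∫ θ in (0:ℝ)..(2 * π),
      (‖ptder φ t θ‖ ^ 2 + ‖pthder φ t θ‖ ^ 2) :=
    intervalIntegral.integral_nonneg (by linarith) fun t _ =>
      intervalIntegral.integral_nonneg (by positivity) fun θ _ => by positivity
  have hF0 : 0 ≤ ∫ t in (-(L : ℝ))..(L : ℝ), ∫ θ in (0:ℝ)..(2 * π),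
        min (exp ((1 - |t - t₀|) / 9)) 1 * ‖f t θ‖ ^ 2 :=
    intervalIntegral.integral_nonneg (by linarith) fun t _ =>
      intervalIntegral.integral_nonneg (by positivity) fun θ _ => by positivity
  have hexp := (exp_pos (-((L : ℝ) - |t₀|) / 9)).le
  have hG := mul_le_mul_of_nonneg_left hgrad hexp
  set M := (2 * π)⁻¹ • ∫ θ in (0:ℝ)..(2 * π), φ t₀ θ
  set D := ∫ t in (-(L : ℝ))..(L : ℝ), ∫ θ in (0:ℝ)..(2 * π),
      (‖ptder φ t θ‖ ^ 2 + ‖pthder φ t θ‖ ^ 2)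
  set H := ∫ t in (-(L : ℝ))..(L : ℝ), ∫ θ in (0:ℝ)..(2 * π),
        min (exp ((1 - |t - t₀|) / 9)) 1 * ‖f t θ‖ ^ 2
  set x := exp (-((L : ℝ) - |t₀|) / 9)
  have hxD : 0 ≤ x * D := mul_nonneg hexp hD0
  have henergy : ∫ θ in (0:ℝ)..(2 * π), ‖pthder φ t₀ θ‖ ^ 2 ≤ 27 / 2 * (x * D + H) := by
    linarith
  have hdev : ‖φ t₀ θ₀ - M‖ ≤ 10 * √(x * D + H) := by
    refine abs_le_of_sq_le_sq' ?_ (by positivity) |>.2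
    rw [mul_pow, sq_sqrt (by linarith)]
    have h1 := mul_le_mul_of_nonneg_left henergy (show 0 ≤ 2 * π by positivity)
    have h2 := mul_le_mul_of_nonneg_right (show 2 * π * (27 / 2) ≤ 10 ^ 2 by
      linarith [pi_lt_d2]) (show 0 ≤ x * D + H by linarith)
    linarith
  have htri := norm_add_le M (φ t₀ θ₀ - M)
  rw [add_sub_cancel] at htri
  linarith
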